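/- arXiv:1905.06605 — 4 statements merged into one kernel-verified Lean document; each statement's English description precedes it below -/
import Mathlib

section
/- Let R, R⁺ ∈ ℝ^{m×m} with R⁺ a Moore–Penrose inverse of R, let T₀ ∈ ℝ^{m×m} be invertible with T₀ (I - R⁺ R) having (in block-row form) its first m - k rows zero and its last k rows equal to a matrix Υ ∈ ℝ^{k×m}. Let B ∈ ℝ^{n×m} and let P, P₁ ∈ ℝ^{n×n} with P₁ symmetric. Define C₀ᵀ ∈ ℝ^{n×k} as the last k columns of P B (I - R⁺ R) T₀⁻¹ and B₀ ∈ ℝ^{n×k} as the last k columns of B (I - R⁺ R) T₀⁻¹. If C₀ + B₀ᵀ P₁ = 0, then (P + P₁) B (I - R⁺ R) = 0. -/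
open Matrix

/-- With `R⁺` a Moore–Penrose inverse of `R`, `T₀` invertible such that `T₀ (I - R⁺R)` has its
first `m - k` rows zero and last `k` rows `Υ`, `C₀ᵀ` the last `k` columns of
`P B (I - R⁺R) T₀⁻¹`, and `B₀` the last `k` columns of `B (I - R⁺R) T₀⁻¹`: if the solvability
condition `C₀ + B₀ᵀ P₁ = 0` holds (`P₁` symmetric), then `(P + P₁) B (I - R⁺R) = 0`. -/
theorem stmt_8 (m k n : ℕ) (hk : k ≤ m)
    (R Rp : Matrix (Fin m) (Fin m) ℝ)
    (h1 : R * Rp * R = R) (h2 : Rp * R * Rp = Rp)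
    (h3 : (R * Rp)ᵀ = R * Rp) (h4 : (Rp * R)ᵀ = Rp * R)
    (T₀ : Matrix (Fin m) (Fin m) ℝ) (hT₀ : IsUnit T₀)
    (Υ : Matrix (Fin k) (Fin m) ℝ)
    (hzero : ∀ i : Fin m, (i : ℕ) < m - k → (T₀ * (1 - Rp * R)) i = 0)
    (hrows : ∀ i : Fin m, ∀ hge : m - k ≤ (i : ℕ),
      (T₀ * (1 - Rp * R)) i = Υ ⟨(i : ℕ) - (m - k), by have := i.isLt; omega⟩)
    (B : Matrix (Fin n) (Fin m) ℝ) (P P₁ : Matrix (Fin n) (Fin n) ℝ)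
    (hP₁symm : P₁.IsSymm)
    (C₀ : Matrix (Fin k) (Fin n) ℝ)
    (hC₀ : ∀ (i : Fin k) (j : Fin n),
      C₀ i j = ((P * B * (1 - Rp * R) * T₀⁻¹ : Matrix (Fin n) (Fin m) ℝ)) j ⟨m - k + (i : ℕ), by have := i.isLt; omega⟩)
    (B₀ : Matrix (Fin n) (Fin k) ℝ)
    (hB₀ : ∀ (j : Fin n) (i : Fin k),
      B₀ j i = ((B * (1 - Rp * R) * T₀⁻¹ : Matrix (Fin n) (Fin m) ℝ)) j ⟨m - k + (i : ℕ), by have := i.isLt; omega⟩)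
    (hcond : C₀ + B₀ᵀ * P₁ = 0) :
    (P + P₁) * B * (1 - Rp * R) = 0 := by
  have hE : (1 - Rp * R) * (1 - Rp * R) = 1 - Rp * R := by
    rw [mul_sub, mul_one, sub_mul, one_mul, ← Matrix.mul_assoc, h2, sub_self, sub_zero]
  have hT : T₀⁻¹ * T₀ = 1 := Matrix.nonsing_inv_mul _ ((Matrix.isUnit_iff_isUnit_det _).1 hT₀)
  have hfactor : (P + P₁) * B * (1 - Rp * R)
      = ((P + P₁) * B * (1 - Rp * R) * T₀⁻¹) * (T₀ * (1 - Rp * R)) := by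
    rw [Matrix.mul_assoc _ T₀⁻¹, ← Matrix.mul_assoc T₀⁻¹, hT, Matrix.one_mul,
      Matrix.mul_assoc _ (1 - Rp * R) (1 - Rp * R), hE]
  have hsplit : (P + P₁) * B * (1 - Rp * R) * T₀⁻¹
      = P * B * (1 - Rp * R) * T₀⁻¹ + P₁ * (B * (1 - Rp * R) * T₀⁻¹) := by
    simp only [Matrix.add_mul, Matrix.mul_assoc]
  have hcol (a : Fin n) (i : Fin k) :
      ((P + P₁) * B * (1 - Rp * R) * T₀⁻¹ : Matrix (Fin n) (Fin m) ℝ) a ⟨m - k + (i : ℕ), by omega⟩ = 0 := by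
    have h := congrFun (congrFun hcond i) a
    rw [Matrix.add_apply, hC₀, Matrix.mul_apply (M := B₀ᵀ), Matrix.zero_apply] at h
    rw [hsplit, Matrix.add_apply, Matrix.mul_apply (M := P₁), ← h]
    congr 1
    refine Finset.sum_congr rfl fun j _ => ?_
    rw [Matrix.transpose_apply, hB₀, hP₁symm.apply, mul_comm]
  rw [hfactor]
  ext a b
  rw [Matrix.mul_apply, Matrix.zero_apply]
  refine Finset.sum_eq_zero fun i _ => ?_
  rcases lt_or_ge (i : ℕ) (m - k) with hi | hi
  · rw [hzero i hi, Pi.zero_apply, mul_zero]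
  · have h := hcol a ⟨(i : ℕ) - (m - k), by omega⟩
    simp only [Nat.add_sub_cancel' hi] at h
    rw [h, zero_mul]
end

section
/- Let t₀ < T, let A, Q : [t₀,T] → ℝ^{n×n}, B : [t₀,T] → ℝ^{n×m}, R⁺ : [t₀,T] → ℝ^{m×m} be continuous with Q(t), R⁺(t) symmetric for all t. Let P, P₁ : [t₀,T] → ℝ^{n×n} be differentiable with P(t), P₁(t) symmetric, satisfying for all t ∈ [t₀,T]: P'(t) = -(A(t)ᵀP(t) + P(t)A(t) + Q(t) - P(t)B(t)R⁺(t)B(t)ᵀP(t)), and, with A₀(t) := A(t) - B(t)R⁺(t)B(t)ᵀP(t) and D₀(t) := -B(t)R⁺(t)B(t)ᵀ, P₁'(t) = -(P₁(t)A₀(t) + A₀(t)ᵀP₁(t) + P₁(t)D₀(t)P₁(t)). Let v : [t₀,T] → ℝⁿ be continuous with (P(t) + P₁(t)) v(t) = 0 for all t, and let x : [t₀,T] → ℝⁿ be differentiable with x'(t) = (A(t) - B(t)R⁺(t)B(t)ᵀ(P(t) + P₁(t))) x(t) + v(t). Then p(t) := (P(t) + P₁(t)) x(t) satisfies p'(t)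 = -(A(t)ᵀ p(t) + Q(t) x(t)) for all t ∈ [t₀,T]. -/
open Matrix Set

/-- Product rule for a matrix-valued function acting on a vector-valued function. -/
theorem hasDerivWithinAt_mulVec {ι κ : Type*} [Fintype ι] [Fintype κ]
    {K : ℝ → Matrix ι κ ℝ} {K' : Matrix ι κ ℝ} {x : ℝ → κ → ℝ} {x' : κ → ℝ} {s : Set ℝ} {t : ℝ}
    (hK : ∀ i j, HasDerivWithinAt (fun r => K r i j) (K' i j) s t)
    (hx : HasDerivWithinAt x x' s t) :
    HasDerivWithinAt (fun r => K r *ᵥ x r) (K' *ᵥ x t + K t *ᵥ x') s t := by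
  rw [hasDerivWithinAt_pi] at hx ⊢
  intro i
  simp only [Pi.add_apply, mulVec, dotProduct, ← Finset.sum_add_distrib]
  exact HasDerivWithinAt.fun_sum fun j _ => (hK i j).fun_mul (hx j)

/-- The sum of a solution of the Riccati equation and a solution of the associated auxiliary
Riccati equation solves the Riccati equation; the resulting drift cancels against the
closed-loop drift. -/
theorem riccati_add_mul_closedLoop {ι κ R : Type*} [Fintype ι] [Fintype κ] [CommRing R]
    {A Q P P₁ : Matrix ι ι R} {B : Matrix ι κ R} {W : Matrix κ κ R}
    (hW : W.IsSymm) (hP : P.IsSymm) :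
    -(Aᵀ * P + P * A + Q - P * B * W * Bᵀ * P)
      + -(P₁ * (A - B * W * Bᵀ * P) + (A - B * W * Bᵀ * P)ᵀ * P₁ + P₁ * (-(B * W * Bᵀ)) * P₁)
      + (P + P₁) * (A - B * W * Bᵀ * (P + P₁)) = -(Aᵀ * (P + P₁) + Q) := by
  have hT : (A - B * W * Bᵀ * P)ᵀ = Aᵀ - P * B * W * Bᵀ := by
    simp only [transpose_sub, transpose_mul, transpose_transpose, hW.eq, hP.eq, Matrix.mul_assoc]
  rw [hT]
  simp only [Matrix.mul_add, Matrix.add_mul, Matrix.mul_sub, Matrix.sub_mul, Matrix.mul_neg,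
    Matrix.neg_mul, Matrix.mul_assoc]
  abel

/-- If `P` solves the Riccati equation (dr1) with pseudo-inverse weight `R⁺`, `P₁` solves the
auxiliary Riccati equation (d3) with `A₀ = A - BR⁺BᵀP`, `D₀ = -BR⁺Bᵀ`, the continuous `v`
satisfies `(P + P₁) v = 0`, and `x' = (A - BR⁺Bᵀ(P + P₁)) x + v`, then `p := (P + P₁) x`
solves the costate equation `p' = -(Aᵀ p + Q x)` on `[t₀,T]`. -/
theorem stmt_9 (n m : ℕ) (t₀ T : ℝ) (ht : t₀ < T)
    (A Q P P₁ : ℝ → Matrix (Fin n) (Fin n) ℝ)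
    (B : ℝ → Matrix (Fin n) (Fin m) ℝ)
    (Rp : ℝ → Matrix (Fin m) (Fin m) ℝ)
    (v x : ℝ → Fin n → ℝ)
    (hAc : ∀ i j, ContinuousOn (fun t => A t i j) (Icc t₀ T))
    (hQc : ∀ i j, ContinuousOn (fun t => Q t i j) (Icc t₀ T))
    (hBc : ∀ i j, ContinuousOn (fun t => B t i j) (Icc t₀ T))
    (hRpc : ∀ i j, ContinuousOn (fun t => Rp t i j) (Icc t₀ T))
    (hQsymm : ∀ t ∈ Icc t₀ T, (Q t).IsSymm)
    (hRpsymm : ∀ t ∈ Icc t₀ T, (Rp t).IsSymm)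
    (hPsymm : ∀ t ∈ Icc t₀ T, (P t).IsSymm)
    (hP₁symm : ∀ t ∈ Icc t₀ T, (P₁ t).IsSymm)
    (hP : ∀ t ∈ Icc t₀ T, ∀ i j, HasDerivWithinAt (fun s => P s i j)
      ((-((A t)ᵀ * P t + P t * A t + Q t - P t * B t * Rp t * (B t)ᵀ * P t)) i j)
      (Icc t₀ T) t)
    (hP₁ : ∀ t ∈ Icc t₀ T, ∀ i j, HasDerivWithinAt (fun s => P₁ s i j)
      ((-(P₁ t * (A t - B t * Rp t * (B t)ᵀ * P t)
          + (A t - B t * Rp t * (B t)ᵀ * P t)ᵀ * P₁ t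
          + P₁ t * (-(B t * Rp t * (B t)ᵀ)) * P₁ t)) i j) (Icc t₀ T) t)
    (hvc : ContinuousOn v (Icc t₀ T))
    (hv : ∀ t ∈ Icc t₀ T, (P t + P₁ t) *ᵥ v t = 0)
    (hx : ∀ t ∈ Icc t₀ T, HasDerivWithinAt x
      ((A t - B t * Rp t * (B t)ᵀ * (P t + P₁ t)) *ᵥ x t + v t) (Icc t₀ T) t) :
    ∀ t ∈ Icc t₀ T, HasDerivWithinAt (fun s => (P s + P₁ s) *ᵥ x s)
      (-((A t)ᵀ *ᵥ ((P t + P₁ t) *ᵥ x t) + Q t *ᵥ x t)) (Icc t₀ T) t := by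
  intro t h
  have hd := hasDerivWithinAt_mulVec (K := fun r => P r + P₁ r) (K' := _ + _)
    (fun i j => (hP t h i j).fun_add (hP₁ t h i j)) (hx t h)
  rwa [mulVec_add _ _ (v t), hv t h, add_zero, mulVec_mulVec, ← add_mulVec,
    riccati_add_mul_closedLoop (hRpsymm t h) (hPsymm t h), neg_mulVec, add_mulVec,
    ← mulVec_mulVec] at hd
end

section
/- Let t₀ < T, let A, Q : [t₀,T] → ℝ^{n×n}, B : [t₀,T] → ℝ^{n×m}, R : [t₀,T] → ℝ^{m×m} be continuous, with Q(t) and R(t) symmetric positive semidefinite for all t, and let H ∈ ℝ^{n×n} be symmetric positive semidefinite. Suppose x, u, p are such that x : [t₀,T] → ℝⁿ is differentiable with x'(t) = A(t)x(t) + B(t)u(t) and x(t₀) = x₀, p : [t₀,T] → ℝⁿ is differentiable with p'(t) = -(A(t)ᵀp(t) + Q(t)x(t)) and p(T) = H x(T), and R(t)u(t) + B(t)ᵀp(t) = 0 for all t ∈ [t₀,T]. Then for every continuous control μ : [t₀,T] → ℝ^m with corresponding state x^μ satisfying (x^μ)'(t) = A(t)x^μ(t) + B(t)μ(t) and x^μ(t₀)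 = x₀, the cost J(μ) := ∫_{t₀}^T (x^μ(t)ᵀQ(t)x^μ(t) + μ(t)ᵀR(t)μ(t)) dt + x^μ(T)ᵀ H x^μ(T) satisfies J(μ) ≥ J(u). -/
open Matrix Set intervalIntegral

/-- The tangent-plane inequality for the convex quadratic form of a positive semidefinite
matrix. -/
theorem Matrix.PosSemidef.quadratic_add_two_mul_le {ι : Type*} [Fintype ι] {M : Matrix ι ι ℝ}
    (hM : M.PosSemidef) (x y : ι → ℝ) :
    x ⬝ᵥ (M *ᵥ x) + 2 * ((M *ᵥ x) ⬝ᵥ (y - x)) ≤ y ⬝ᵥ (M *ᵥ y) := by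
  have hnonneg : 0 ≤ (y - x) ⬝ᵥ (M *ᵥ (y - x)) := by
    simpa using hM.dotProduct_mulVec_nonneg (y - x)
  have hsymm : x ⬝ᵥ (M *ᵥ y) = y ⬝ᵥ (M *ᵥ x) := by
    have hT : Mᵀ = M := by simpa using hM.isHermitian.eq
    rw [dotProduct_mulVec, ← mulVec_transpose, hT, dotProduct_comm]
  rw [dotProduct_comm (M *ᵥ x)]
  simp only [mulVec_sub, sub_dotProduct, dotProduct_sub] at hnonneg ⊢
  linarith

theorem ContinuousOn.dotProduct_mulVec {ι κ : Type*} [Fintype ι] [Fintype κ]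
    {M : ℝ → Matrix ι κ ℝ} {v : ℝ → ι → ℝ} {w : ℝ → κ → ℝ} {s : Set ℝ}
    (hv : ContinuousOn v s) (hM : ∀ i j, ContinuousOn (fun t => M t i j) s)
    (hw : ContinuousOn w s) :
    ContinuousOn (fun t => v t ⬝ᵥ (M t *ᵥ w t)) s := by
  rw [continuousOn_pi] at hv hw
  simp only [dotProduct, mulVec]
  exact continuousOn_finsetSum _ fun i _ =>
    (hv i).mul (continuousOn_finsetSum _ fun j _ => (hM i j).mul (hw j))

theorem HasDerivWithinAt.dotProduct {ι : Type*} [Fintype ι] {f g : ℝ → ι → ℝ} {f' g' : ι → ℝ}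
    {s : Set ℝ} {t : ℝ} (hf : HasDerivWithinAt f f' s t) (hg : HasDerivWithinAt g g' s t) :
    HasDerivWithinAt (fun r => f r ⬝ᵥ g r) (f' ⬝ᵥ g t + f t ⬝ᵥ g') s t := by
  rw [hasDerivWithinAt_pi] at hf hg
  simp only [_root_.dotProduct, ← Finset.sum_add_distrib]
  exact HasDerivWithinAt.fun_sum fun i _ => (hf i).mul (hg i)

/-- Sufficiency direction of the maximum principle: a control–state–costate triple `(u, x, p)`
satisfying `x' = Ax + Bu`, `p' = -(Aᵀp + Qx)`, `p(T) = Hx(T)`, and `Ru + Bᵀp = 0` is globally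
optimal for the quadratic cost with positive semidefinite weights `Q, R, H`. -/
theorem stmt_10 (n m : ℕ) (t₀ T : ℝ) (ht : t₀ < T)
    (A Q : ℝ → Matrix (Fin n) (Fin n) ℝ)
    (B : ℝ → Matrix (Fin n) (Fin m) ℝ)
    (R : ℝ → Matrix (Fin m) (Fin m) ℝ)
    (H : Matrix (Fin n) (Fin n) ℝ)
    (hAc : ∀ i j, ContinuousOn (fun t => A t i j) (Icc t₀ T))
    (hQc : ∀ i j, ContinuousOn (fun t => Q t i j) (Icc t₀ T))
    (hBc : ∀ i j, ContinuousOn (fun t => B t i j) (Icc t₀ T))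
    (hRc : ∀ i j, ContinuousOn (fun t => R t i j) (Icc t₀ T))
    (hQpsd : ∀ t ∈ Icc t₀ T, (Q t).PosSemidef)
    (hRpsd : ∀ t ∈ Icc t₀ T, (R t).PosSemidef)
    (hHpsd : H.PosSemidef)
    (x₀ : Fin n → ℝ) (x p : ℝ → Fin n → ℝ) (u : ℝ → Fin m → ℝ)
    (huc : ContinuousOn u (Icc t₀ T))
    (hx0 : x t₀ = x₀)
    (hx : ∀ t ∈ Icc t₀ T, HasDerivWithinAt x (A t *ᵥ x t + B t *ᵥ u t) (Icc t₀ T) t)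
    (hp : ∀ t ∈ Icc t₀ T, HasDerivWithinAt p (-((A t)ᵀ *ᵥ p t + Q t *ᵥ x t)) (Icc t₀ T) t)
    (hpT : p T = H *ᵥ x T)
    (heq : ∀ t ∈ Icc t₀ T, R t *ᵥ u t + (B t)ᵀ *ᵥ p t = 0) :
    ∀ (μ : ℝ → Fin m → ℝ) (xμ : ℝ → Fin n → ℝ),
      ContinuousOn μ (Icc t₀ T) →
      xμ t₀ = x₀ →
      (∀ t ∈ Icc t₀ T, HasDerivWithinAt xμ (A t *ᵥ xμ t + B t *ᵥ μ t) (Icc t₀ T) t) →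
      (∫ t in t₀..T, (x t ⬝ᵥ (Q t *ᵥ x t) + u t ⬝ᵥ (R t *ᵥ u t))) + x T ⬝ᵥ (H *ᵥ x T)
        ≤ (∫ t in t₀..T, (xμ t ⬝ᵥ (Q t *ᵥ xμ t) + μ t ⬝ᵥ (R t *ᵥ μ t)))
            + xμ T ⬝ᵥ (H *ᵥ xμ T) := by
  intro μ xμ hμc hxμ0 hxμ
  have hxc : ContinuousOn x (Icc t₀ T) := fun t h => (hx t h).continuousWithinAt
  have hxμc : ContinuousOn xμ (Icc t₀ T) := fun t h => (hxμ t h).continuousWithinAt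
  have hderiv : ∀ t ∈ Icc t₀ T, HasDerivWithinAt (fun s => p s ⬝ᵥ (xμ s - x s))
      (-((xμ t - x t) ⬝ᵥ (Q t *ᵥ x t) + (μ t - u t) ⬝ᵥ (R t *ᵥ u t))) (Icc t₀ T) t := by
    intro t h
    convert (hp t h).dotProduct ((hxμ t h).fun_sub (hx t h)) using 1
    have hdiff : A t *ᵥ xμ t + B t *ᵥ μ t - (A t *ᵥ x t + B t *ᵥ u t)
        = A t *ᵥ (xμ t - x t) + B t *ᵥ (μ t - u t) := by
      rw [mulVec_sub, mulVec_sub]; abel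
    have hRu : R t *ᵥ u t = -((B t)ᵀ *ᵥ p t) := eq_neg_of_add_eq_zero_left (heq t h)
    rw [hdiff, hRu, dotProduct_add, dotProduct_mulVec (p t), dotProduct_mulVec (p t),
      ← mulVec_transpose, ← mulVec_transpose, dotProduct_comm (xμ t - x t),
      dotProduct_comm (μ t - u t), neg_dotProduct, neg_dotProduct, add_dotProduct]
    ring
  have hJu : ContinuousOn (fun t => x t ⬝ᵥ (Q t *ᵥ x t) + u t ⬝ᵥ (R t *ᵥ u t)) (Icc t₀ T) :=
    (hxc.dotProduct_mulVec hQc hxc).add (huc.dotProduct_mulVec hRc huc)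
  have hJμ : ContinuousOn (fun t => xμ t ⬝ᵥ (Q t *ᵥ xμ t) + μ t ⬝ᵥ (R t *ᵥ μ t)) (Icc t₀ T) :=
    (hxμc.dotProduct_mulVec hQc hxμc).add (hμc.dotProduct_mulVec hRc hμc)
  have hcross : ContinuousOn
      (fun t => -((xμ t - x t) ⬝ᵥ (Q t *ᵥ x t) + (μ t - u t) ⬝ᵥ (R t *ᵥ u t))) (Icc t₀ T) :=
    (((hxμc.sub hxc).dotProduct_mulVec hQc hxc).add
      ((hμc.sub huc).dotProduct_mulVec hRc huc)).neg
  have hcross_int := hcross.intervalIntegrable_of_Icc (μ := MeasureTheory.volume) ht.le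
  have hJu_int := hJu.intervalIntegrable_of_Icc (μ := MeasureTheory.volume) ht.le
  have hftc := integral_eq_sub_of_hasDerivAt_of_le ht.le
    (fun t h => (hderiv t h).continuousWithinAt)
    (fun t h => (hderiv t (Ioo_subset_Icc_self h)).hasDerivAt (Icc_mem_nhds h.1 h.2)) hcross_int
  rw [hx0, hxμ0, sub_self, dotProduct_zero, sub_zero, hpT] at hftc
  have hmono := integral_mono_on ht.le (hJu_int.sub (hcross_int.const_mul 2))
    (hJμ.intervalIntegrable_of_Icc ht.le) fun t h => by
      have h₁ := (hQpsd t h).quadratic_add_two_mul_le (x t) (xμ t)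
      have h₂ := (hRpsd t h).quadratic_add_two_mul_le (u t) (μ t)
      rw [dotProduct_comm (Q t *ᵥ x t)] at h₁
      rw [dotProduct_comm (R t *ᵥ u t)] at h₂
      linarith
  rw [integral_sub hJu_int (hcross_int.const_mul 2), integral_const_mul, hftc] at hmono
  linarith [hHpsd.quadratic_add_two_mul_le (x T) (xμ T)]
end

section
/- Let t₀ < T, let A₀, D₀ : [t₀,T] → ℝ^{n×n}, B₀ : [t₀,T] → ℝ^{n×k}, C₀ : [t₀,T] → ℝ^{k×n} be continuous, and suppose P₁ : [t₀,T] → ℝ^{n×n} is differentiable with P₁'(t) = -(P₁(t)A₀(t) + A₀(t)ᵀP₁(t) + P₁(t)D₀(t)P₁(t)) and P₁(t)B₀(t) = -C₀(t)ᵀ for all t. Let Φ : [t₀,T] → ℝ^{n×n} be differentiable with Φ(t₀) = I, Φ'(s) = Φ(s)A₀(s)ᵀ, and Φ(s) invertible for all s, and set G₁ := ∫_{t₀}^T Φ(s)C₀(s)ᵀC₀(s)Φ(s)ᵀ ds. Then the following are equivalent: (i) for every x₀ ∈ ℝⁿ there exist a continuous control u₁ : [t₀,T] → ℝᵏ and a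 differentiable m : [t₀,T] → ℝⁿ with m(t₀) = x₀, m'(t) = (A₀(t) + D₀(t)P₁(t))m(t) + B₀(t)u₁(t), and P₁(T)m(T) = 0; (ii) the range of P₁(t₀) is contained in the range of G₁. -/
open Matrix Set intervalIntegral

open scoped NNReal

section LinearODE

variable {ι : Type*} [Fintype ι]

/-- A continuous-in-time, globally Lipschitz vector field has a solution on the whole of a compact
interval, for every initial value. -/
theorem exists_forall_mem_Icc_hasDerivWithinAt_of_lipschitzWith {a b : ℝ} (hab : a ≤ b)
    {f : ℝ → (ι → ℝ) → ι → ℝ} {K : ℝ≥0} (hlip : ∀ t ∈ Icc a b, LipschitzWith K (f t))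
    (hcont : ∀ x, ContinuousOn (f · x) (Icc a b)) (x₀ : ι → ℝ) :
    ∃ x : ℝ → ι → ℝ, x a = x₀ ∧
      ∀ t ∈ Icc a b, HasDerivWithinAt x (f t (x t)) (Icc a b) t := by
  obtain ⟨c, hc⟩ := isCompact_Icc.exists_bound_of_continuousOn (hcont 0)
  have hc0 : 0 ≤ c := (norm_nonneg _).trans (hc a (left_mem_Icc.2 hab))
  have hgrowth : ∀ t ∈ Icc a b, ∀ x, ‖f t x‖ ≤ K * ‖x‖ + c := by
    intro t ht x
    have h := (hlip t ht).dist_le_mul x 0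
    rw [dist_eq_norm, dist_zero_right] at h
    linarith [norm_le_norm_sub_add (f t x) (f t 0), hc t ht]
  -- Truncate the vector field outside a ball that Gronwall's inequality says is never left.
  set R : ℝ := max 0 (gronwallBound ‖x₀‖ K c (b - a))
  have hR0 : 0 ≤ R := le_max_left _ _
  have hRR : -R ≤ R := by linarith
  set p : (ι → ℝ) → ι → ℝ := fun x i => (projIcc (-R) R hRR (x i) : ℝ) with hp
  have hplip : LipschitzWith 1 p := by
    refine LipschitzWith.of_dist_le_mul fun x y => ?_
    rw [NNReal.coe_one, one_mul]
    refine (dist_pi_le_iff dist_nonneg).2 fun i => ?_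
    have h := (LipschitzWith.projIcc hRR).dist_le_mul (x i) (y i)
    rw [NNReal.coe_one, one_mul] at h
    exact h.trans (dist_le_pi_dist x y i)
  have hp_of_norm_le : ∀ x, ‖x‖ ≤ R → p x = x := by
    intro x hx
    funext i
    have hi : x i ∈ Icc (-R) R := abs_le.1 ((norm_le_pi_norm x i).trans hx)
    simp only [hp, projIcc_of_mem hRR hi]
  have hp_norm : ∀ x, ‖p x‖ ≤ ‖x‖ := by
    intro x
    have h := hplip.dist_le_mul x 0
    rwa [hp_of_norm_le 0 (by simpa using hR0), dist_zero_right, dist_zero_right, NNReal.coe_one,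
      one_mul] at h
  have hp_le : ∀ x, ‖p x‖ ≤ R := fun x =>
    (pi_norm_le_iff_of_nonneg hR0).2 fun i => abs_le.2 (projIcc (-R) R hRR (x i)).2
  have hL0 : 0 ≤ K * R + c := by positivity
  have hpl : IsPicardLindelof (fun t x => f t (p x)) (⟨a, left_mem_Icc.2 hab⟩ : Icc a b) x₀
      ((K * R + c) * (b - a)).toNNReal 0 (K * R + c).toNNReal K := by
    refine ⟨fun t ht => ?_, fun x _ => hcont (p x), fun t ht x _ => ?_, ?_⟩
    · have h := (hlip t ht).comp hplip
      rw [mul_one] at h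
      exact h.lipschitzOnWith
    · rw [Real.coe_toNNReal _ hL0]
      exact (hgrowth t ht _).trans (by gcongr; exact hp_le x)
    · have : 0 ≤ b - a := sub_nonneg.2 hab
      rw [Real.coe_toNNReal _ hL0, Real.coe_toNNReal _ (by positivity)]
      simp [this]
  obtain ⟨x, hxa, hx⟩ := hpl.exists_eq_forall_mem_Icc_hasDerivWithinAt₀
  refine ⟨x, hxa, fun t ht => ?_⟩
  have hbound := norm_le_gronwallBound_of_norm_deriv_right_le (f := x) (δ := ‖x₀‖) (K := K) (ε := c)
    (fun t ht => (hx t ht).continuousWithinAt)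
    (fun t ht => (hx t (Ico_subset_Icc_self ht)).mono_of_mem_nhdsWithin
      (Icc_mem_nhdsGE_of_mem ht))
    (by simp [← hxa])
    (fun t ht => (hgrowth t (Ico_subset_Icc_self ht) _).trans (by gcongr; exact hp_norm _)) t ht
  have hxR : ‖x t‖ ≤ R := hbound.trans <|
    (gronwallBound_mono (norm_nonneg _) hc0 K.2 (by linarith [ht.2])).trans (le_max_right _ _)
  simpa only [hp_of_norm_le _ hxR] using hx t ht

theorem Matrix.norm_mulVec_le_sum (M : Matrix ι ι ℝ) (x : ι → ℝ) :
    ‖M *ᵥ x‖ ≤ (∑ i, ∑ j, |M i j|) * ‖x‖ := by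
  refine (pi_norm_le_iff_of_nonneg (by positivity)).2 fun i => ?_
  calc ‖(M *ᵥ x) i‖ ≤ ∑ j, ‖M i j * x j‖ := norm_sum_le _ _
    _ ≤ ∑ j, |M i j| * ‖x‖ := by
        gcongr with j
        rw [norm_mul, Real.norm_eq_abs]
        gcongr
        exact norm_le_pi_norm x j
    _ = (∑ j, |M i j|) * ‖x‖ := by rw [Finset.sum_mul]
    _ ≤ _ := by
        refine mul_le_mul_of_nonneg_right ?_ (norm_nonneg x)
        exact Finset.single_le_sum (f := fun i => ∑ j, |M i j|) (fun _ _ => by positivity)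
          (Finset.mem_univ i)

/-- The linear initial value problem `x' = M x + w`, `x a = x₀` is solvable on `[a, b]`. -/
theorem exists_linear_ode_solution {a b : ℝ} (hab : a ≤ b) {M : ℝ → Matrix ι ι ℝ} {w : ℝ → ι → ℝ}
    (hM : ContinuousOn M (Icc a b)) (hw : ContinuousOn w (Icc a b)) (x₀ : ι → ℝ) :
    ∃ x : ℝ → ι → ℝ, x a = x₀ ∧
      ∀ t ∈ Icc a b, HasDerivWithinAt x (M t *ᵥ x t + w t) (Icc a b) t := by
  have hsum : ContinuousOn (fun t => ∑ i, ∑ j, |M t i j|) (Icc a b) := by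
    refine continuousOn_finsetSum _ fun i _ => continuousOn_finsetSum _ fun j _ => ?_
    exact (continuousOn_pi.1 (continuousOn_pi.1 hM i) j).abs
  obtain ⟨K, hK⟩ := isCompact_Icc.exists_bound_of_continuousOn hsum
  refine exists_forall_mem_Icc_hasDerivWithinAt_of_lipschitzWith hab
    (f := fun t x => M t *ᵥ x + w t) (K := K.toNNReal) (fun t ht => ?_) (fun x => ?_) x₀
  · refine LipschitzWith.of_dist_le_mul fun x y => ?_
    rw [dist_add_right, dist_eq_norm, ← mulVec_sub, dist_eq_norm]
    refine (norm_mulVec_le_sum _ _).trans ?_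
    gcongr
    exact (le_abs_self _).trans ((hK t ht).trans (Real.le_coe_toNNReal K))
  · refine ContinuousOn.add ?_ hw
    rw [continuousOn_iff_continuous_domRestrict] at hM ⊢
    exact hM.matrix_mulVec continuous_const

end LinearODE

section MatrixCalculus

variable {l m n : Type*}

theorem ContinuousOn.matrix_mul {X : Type*} [TopologicalSpace X] {s : Set X}
    [Fintype m] {M : X → Matrix l m ℝ} {N : X → Matrix m n ℝ}
    (hM : ContinuousOn M s) (hN : ContinuousOn N s) : ContinuousOn (fun t => M t * N t) s := by
  rw [continuousOn_iff_continuous_domRestrict] at hM hN ⊢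
  exact Continuous.matrix_mul hM hN

theorem ContinuousOn.matrix_transpose {X : Type*} [TopologicalSpace X] {s : Set X}
    {M : X → Matrix l m ℝ} (hM : ContinuousOn M s) : ContinuousOn (fun t => (M t)ᵀ) s := by
  rw [continuousOn_iff_continuous_domRestrict] at hM ⊢
  exact Continuous.matrix_transpose hM

theorem ContinuousOn.matrix_mulVec {X : Type*} [TopologicalSpace X] {s : Set X}
    [Fintype m] {M : X → Matrix l m ℝ} {v : X → m → ℝ}
    (hM : ContinuousOn M s) (hv : ContinuousOn v s) : ContinuousOn (fun t => M t *ᵥ v t) s := by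
  rw [continuousOn_iff_continuous_domRestrict] at hM hv ⊢
  exact Continuous.matrix_mulVec hM hv

theorem continuousOn_matrix {X : Type*} [TopologicalSpace X] {s : Set X}
    {M : X → Matrix l m ℝ} (h : ∀ i j, ContinuousOn (fun t => M t i j) s) : ContinuousOn M s :=
  continuousOn_pi.2 fun i => continuousOn_pi.2 fun j => h i j

theorem HasDerivWithinAt.matrix_mulVec [Fintype m] {M : ℝ → Matrix l m ℝ} {M' : Matrix l m ℝ}
    {v : ℝ → m → ℝ} {v' : m → ℝ} {s : Set ℝ} {t : ℝ}
    (hM : ∀ i j, HasDerivWithinAt (fun r => M r i j) (M' i j) s t)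
    (hv : HasDerivWithinAt v v' s t) :
    HasDerivWithinAt (fun r => M r *ᵥ v r) (M' *ᵥ v t + M t *ᵥ v') s t := by
  refine hasDerivWithinAt_pi.2 fun i => ?_
  have h := HasDerivWithinAt.fun_sum (u := Finset.univ) fun j _ =>
    (hM i j).mul (hasDerivWithinAt_pi.1 hv j)
  rw [Finset.sum_add_distrib] at h
  exact h

end MatrixCalculus

section Gramian

variable {m n : Type*} [Fintype m] [Fintype n] {a b : ℝ} {W : ℝ → Matrix n m ℝ}
  {G : Matrix n n ℝ}

theorem gramian_mulVec (hab : a ≤ b) (hW : ContinuousOn W (Icc a b))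
    (hG : ∀ i j, G i j = ∫ s in a..b, (W s * (W s)ᵀ) i j) (z : n → ℝ) :
    G *ᵥ z = ∫ s in a..b, W s *ᵥ ((W s)ᵀ *ᵥ z) := by
  have hWW := hW.matrix_mul hW.matrix_transpose
  have hint := (hWW.matrix_mulVec (continuousOn_const (c := z))).intervalIntegrable_of_Icc
    (μ := MeasureTheory.volume) hab
  simp only [mulVec_mulVec]
  funext i
  have happly :=
    (ContinuousLinearMap.proj (R := ℝ) (φ := fun _ : n => ℝ) i).intervalIntegral_comp_comm hint
  simp only [ContinuousLinearMap.proj_apply] at happly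
  rw [← happly]
  simp only [mulVec, dotProduct]
  rw [intervalIntegral.integral_finsetSum]
  · exact Finset.sum_congr rfl fun j _ => by rw [hG, intervalIntegral.integral_mul_const]
  · intro j _
    exact ((continuousOn_pi.1 (continuousOn_pi.1 hWW i) j).mul
      continuousOn_const).intervalIntegrable_of_Icc hab

/-- Everything reachable with a continuous control lies in the range of the Gramian. -/
theorem integral_mulVec_mem_range_gramian (hab : a < b) (hW : ContinuousOn W (Icc a b))
    (hG : ∀ i j, G i j = ∫ s in a..b, (W s * (W s)ᵀ) i j)
    {u : ℝ → m → ℝ} (hu : ContinuousOn u (Icc a b)) :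
    ∫ s in a..b, W s *ᵥ u s ∈ Set.range G.mulVec := by
  by_contra hmem
  have hnonneg : ∀ y : m → ℝ, 0 ≤ y ⬝ᵥ y := fun y =>
    Finset.sum_nonneg fun i _ => mul_self_nonneg (y i)
  obtain ⟨f, hf, hker⟩ := Submodule.exists_le_ker_of_notMem (p := LinearMap.range G.mulVecLin)
    (v := ∫ s in a..b, W s *ᵥ u s) fun h => hmem (by simpa using h)
  classical
  obtain ⟨v, rfl⟩ : ∃ v, dotProductBilin ℝ ℝ v = f := (dotProductEquiv ℝ n).surjective f
  have hcomm : ∀ {y : ℝ → m → ℝ}, ContinuousOn y (Icc a b) →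
      v ⬝ᵥ ∫ s in a..b, W s *ᵥ y s = ∫ s in a..b, ((W s)ᵀ *ᵥ v) ⬝ᵥ y s := by
    intro y hy
    have h := (LinearMap.toContinuousLinearMap (dotProductBilin ℝ ℝ v)).intervalIntegral_comp_comm
      ((hW.matrix_mulVec hy).intervalIntegrable_of_Icc (μ := MeasureTheory.volume) hab.le)
    simpa [dotProduct_mulVec, mulVec_transpose] using h.symm
  have hWv : ContinuousOn (fun s => (W s)ᵀ *ᵥ v) (Icc a b) :=
    hW.matrix_transpose.matrix_mulVec continuousOn_const
  have hzero : ∀ s ∈ Icc a b, (W s)ᵀ *ᵥ v = 0 := by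
    by_contra! hne
    obtain ⟨c, hc, hcne⟩ := hne
    have hpos : 0 < ∫ s in a..b, ((W s)ᵀ *ᵥ v) ⬝ᵥ ((W s)ᵀ *ᵥ v) := by
      refine intervalIntegral.integral_pos hab ?_ (fun s _ => hnonneg _)
        ⟨c, hc, (hnonneg _).lt_of_ne' (dotProduct_self_eq_zero.not.2 hcne)⟩
      exact continuousOn_finsetSum _ fun i _ =>
        (continuousOn_pi.1 hWv i).mul (continuousOn_pi.1 hWv i)
    rw [← hcomm hWv, ← gramian_mulVec hab.le hW hG] at hpos
    have : v ⬝ᵥ G *ᵥ v = 0 := hker ⟨v, rfl⟩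
    exact hpos.ne' this
  refine hf ((hcomm hu).trans ?_)
  rw [intervalIntegral.integral_congr (g := fun _ => 0)]
  · simp
  · intro s hs
    rw [uIcc_of_le hab.le] at hs
    simp [hzero s hs]

end Gramian

/-- The adjoint variable `P m` of a controlled trajectory `m`, transported by `Φ`, evolves by
accumulating the control through `Φ Cᵀ`. -/
theorem transition_mulVec_costate_eq_sub_integral {n k : Type*} [Fintype n] [Fintype k]
    {a b : ℝ} (hab : a ≤ b) {A D P Φ : ℝ → Matrix n n ℝ} {B : ℝ → Matrix n k ℝ}
    {C : ℝ → Matrix k n ℝ}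
    (hP : ∀ t ∈ Icc a b, ∀ i j, HasDerivWithinAt (fun s => P s i j)
      ((-(P t * A t + (A t)ᵀ * P t + P t * D t * P t)) i j) (Icc a b) t)
    (hPB : ∀ t ∈ Icc a b, P t * B t = -(C t)ᵀ)
    (hΦ : ∀ s ∈ Icc a b, ∀ i j, HasDerivWithinAt (fun r => Φ r i j)
      ((Φ s * (A s)ᵀ) i j) (Icc a b) s)
    (hW : ContinuousOn (fun s => Φ s * (C s)ᵀ) (Icc a b))
    {u : ℝ → k → ℝ} (hu : ContinuousOn u (Icc a b)) {x : ℝ → n → ℝ}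
    (hx : ∀ t ∈ Icc a b, HasDerivWithinAt x
      ((A t + D t * P t) *ᵥ x t + B t *ᵥ u t) (Icc a b) t) :
    Φ b *ᵥ (P b *ᵥ x b) = Φ a *ᵥ (P a *ᵥ x a) - ∫ s in a..b, (Φ s * (C s)ᵀ) *ᵥ u s := by
  have hderiv : ∀ t ∈ Icc a b, HasDerivWithinAt (fun s => Φ s *ᵥ (P s *ᵥ x s))
      (-((Φ t * (C t)ᵀ) *ᵥ u t)) (Icc a b) t := by
    intro t ht
    convert! HasDerivWithinAt.matrix_mulVec (hΦ t ht)
      (HasDerivWithinAt.matrix_mulVec (hP t ht) (hx t ht)) using 1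
    have hC : (C t)ᵀ = -(P t * B t) := by rw [hPB t ht, neg_neg]
    simp only [hC, mulVec_add, mulVec_mulVec, neg_mulVec, mulVec_neg, add_mulVec,
      Matrix.mul_neg, Matrix.mul_assoc, neg_neg]
    abel
  have hftc := intervalIntegral.integral_eq_sub_of_hasDerivAt_of_le hab
    (fun t ht => (hderiv t ht).continuousWithinAt)
    (fun t ht => (hderiv t (Ioo_subset_Icc_self ht)).hasDerivAt (Icc_mem_nhds ht.1 ht.2))
    ((hW.matrix_mulVec hu).neg.intervalIntegrable_of_Icc hab)
  rw [intervalIntegral.integral_neg] at hftc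
  rw [sub_eq_add_neg, hftc]
  abel

/-- Open-loop solvability characterization (Theorem 3): under the auxiliary Riccati equation
for `P₁`, the coupling condition `P₁B₀ = -C₀ᵀ`, the transition matrix `Φ` of `A₀ᵀ`, and the
controllability Gramian `G₁`, the terminal constraint `P₁(T)m(T) = 0` is achievable from every
initial state `x₀` iff `Range P₁(t₀) ⊆ Range G₁`. -/
theorem stmt_15 (n k : ℕ) (t₀ T : ℝ) (ht : t₀ < T)
    (A₀ D₀ : ℝ → Matrix (Fin n) (Fin n) ℝ)
    (B₀ : ℝ → Matrix (Fin n) (Fin k) ℝ)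
    (C₀ : ℝ → Matrix (Fin k) (Fin n) ℝ)
    (hA₀c : ∀ i j, ContinuousOn (fun t => A₀ t i j) (Icc t₀ T))
    (hD₀c : ∀ i j, ContinuousOn (fun t => D₀ t i j) (Icc t₀ T))
    (hB₀c : ∀ i j, ContinuousOn (fun t => B₀ t i j) (Icc t₀ T))
    (hC₀c : ∀ i j, ContinuousOn (fun t => C₀ t i j) (Icc t₀ T))
    (P₁ : ℝ → Matrix (Fin n) (Fin n) ℝ)
    (hP₁ : ∀ t ∈ Icc t₀ T, ∀ i j, HasDerivWithinAt (fun s => P₁ s i j)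
      ((-(P₁ t * A₀ t + (A₀ t)ᵀ * P₁ t + P₁ t * D₀ t * P₁ t)) i j) (Icc t₀ T) t)
    (hP₁B₀ : ∀ t ∈ Icc t₀ T, P₁ t * B₀ t = -(C₀ t)ᵀ)
    (Φ : ℝ → Matrix (Fin n) (Fin n) ℝ)
    (hΦ0 : Φ t₀ = 1)
    (hΦ : ∀ s ∈ Icc t₀ T, ∀ i j, HasDerivWithinAt (fun r => Φ r i j)
      ((Φ s * (A₀ s)ᵀ) i j) (Icc t₀ T) s)
    (hΦinv : ∀ s ∈ Icc t₀ T, IsUnit (Φ s))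
    (G₁ : Matrix (Fin n) (Fin n) ℝ)
    (hG₁ : ∀ i j, G₁ i j = ∫ s in t₀..T, (Φ s * (C₀ s)ᵀ * C₀ s * (Φ s)ᵀ) i j) :
    (∀ x₀ : Fin n → ℝ,
      ∃ (u₁ : ℝ → Fin k → ℝ) (xm : ℝ → Fin n → ℝ),
        ContinuousOn u₁ (Icc t₀ T) ∧ xm t₀ = x₀ ∧
        (∀ t ∈ Icc t₀ T, HasDerivWithinAt xm
          ((A₀ t + D₀ t * P₁ t) *ᵥ xm t + B₀ t *ᵥ u₁ t) (Icc t₀ T) t) ∧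
        P₁ T *ᵥ xm T = 0)
    ↔ Set.range (P₁ t₀).mulVec ⊆ Set.range G₁.mulVec := by
  set W : ℝ → Matrix (Fin n) (Fin k) ℝ := fun s => Φ s * (C₀ s)ᵀ with hWdef
  have hP₁c : ContinuousOn P₁ (Icc t₀ T) :=
    continuousOn_matrix fun i j t ht => (hP₁ t ht i j).continuousWithinAt
  have hΦc : ContinuousOn Φ (Icc t₀ T) :=
    continuousOn_matrix fun i j t ht => (hΦ t ht i j).continuousWithinAt
  have hW : ContinuousOn W (Icc t₀ T) :=
    hΦc.matrix_mul (continuousOn_matrix hC₀c).matrix_transpose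
  have hG : ∀ i j, G₁ i j = ∫ s in t₀..T, (W s * (W s)ᵀ) i j := by
    intro i j
    simp only [hG₁, hWdef, transpose_mul, transpose_transpose, Matrix.mul_assoc]
  constructor
  · rintro h _ ⟨x₀, rfl⟩
    obtain ⟨u, x, hu, rfl, hx, hxT⟩ := h x₀
    have key := transition_mulVec_costate_eq_sub_integral ht.le hP₁ hP₁B₀ hΦ hW hu hx
    rw [hxT, mulVec_zero, hΦ0, one_mulVec, eq_comm, sub_eq_zero] at key
    rw [key]
    exact integral_mulVec_mem_range_gramian ht hW hG hu
  · intro h x₀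
    obtain ⟨z, hz⟩ := h ⟨x₀, rfl⟩
    have hu : ContinuousOn (fun s => (W s)ᵀ *ᵥ z) (Icc t₀ T) :=
      hW.matrix_transpose.matrix_mulVec continuousOn_const
    obtain ⟨x, hx0, hx⟩ := exists_linear_ode_solution ht.le
      ((continuousOn_matrix hA₀c).add ((continuousOn_matrix hD₀c).matrix_mul hP₁c))
      ((continuousOn_matrix hB₀c).matrix_mulVec hu) x₀
    refine ⟨_, x, hu, hx0, hx, ?_⟩
    have key := transition_mulVec_costate_eq_sub_integral ht.le hP₁ hP₁B₀ hΦ hW hu hx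
    rw [← gramian_mulVec ht.le hW hG, hz, hx0, hΦ0, one_mulVec, sub_self] at key
    exact mulVec_injective_of_isUnit (hΦinv T (right_mem_Icc.2 ht.le))
      (key.trans (mulVec_zero _).symm)
end
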